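/- Let n = 4 or n = 5, and let α > 0. Define u₀(y) = ((n−3)/2) · y/(1−y) + y · ( Σ_{m=1}^∞ m d_m (1−y)^{m−1} ) / G(y) for y ∈ (0,1). Then ∫₀¹ y^{α−1} (1−y)^{(n−3)/2} G(y) · u₀(y)² dy = +∞. -/

import Mathlib

open MeasureTheory Set

/-- The recursively defined coefficients `γ_i(m)` from the paper (depending on `n`). -/
noncomputable def gammaCoeff (n : ℕ) : ℕ → ℕ → ℝ
  | 0, _ => 0
  | 1, m => if m = 0 then 1 else 0
  | (i + 2), m =>
      (Real.Gamma ((m : ℝ) + ((i : ℝ) + 1) * ((i : ℝ) + 2) / (2 * (n : ℝ))) /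
        Real.Gamma ((m : ℝ) + ((i : ℝ) + 2) * ((i : ℝ) + 3) / (2 * (n : ℝ)))) *
      ∑ k ∈ Finset.range (m + 1),
        (Real.Gamma (((m - k : ℕ) : ℝ) + ((i : ℝ) + 2) / (n : ℝ)) /
          (Nat.factorial (m - k) : ℝ)) * gammaCoeff n (i + 1) k

/-- `d_m = γ_{n−1}(m)`. -/
noncomputable def dCoeff (n : ℕ) (m : ℕ) : ℝ := gammaCoeff n (n - 1) m

/-- `G(y) = Σ_{m≥0} d_m (1−y)^m`. -/
noncomputable def Gfun (n : ℕ) (y : ℝ) : ℝ := ∑' m : ℕ, dCoeff n m * (1 - y) ^ m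

lemma gammaCoeff_nonneg {n : ℕ} (hn : 0 < n) (i m : ℕ) : 0 ≤ gammaCoeff n i m := by
  have hn' : (0 : ℝ) < n := by exact_mod_cast hn
  induction i generalizing m with
  | zero => simp [gammaCoeff]
  | succ i ih =>
    cases i with
    | zero => rw [gammaCoeff]; split_ifs <;> norm_num
    | succ i =>
      rw [gammaCoeff]
      refine mul_nonneg (div_nonneg ?_ ?_) (Finset.sum_nonneg fun k _ =>
        mul_nonneg (div_nonneg ?_ (by positivity)) (ih k)) <;>
      exact (Real.Gamma_pos_of_pos (by positivity)).le

lemma gammaCoeff_zero_pos {n : ℕ} (hn : 0 < n) (i : ℕ) : 0 < gammaCoeff n (i + 1) 0 := by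
  have hn' : (0 : ℝ) < n := by exact_mod_cast hn
  induction i with
  | zero => simp [gammaCoeff]
  | succ i ih =>
    rw [gammaCoeff]
    simp only [zero_add, Finset.sum_range_one]
    refine mul_pos (div_pos ?_ ?_) (mul_pos (div_pos ?_ (by positivity)) ih) <;>
    exact Real.Gamma_pos_of_pos (by positivity)

lemma Gamma_natCast_add_div_le {s t : ℝ} (hs : 0 < s) (hst : s ≤ t) (m : ℕ) :
    Real.Gamma (m + s) / Real.Gamma (m + t) ≤ Real.Gamma s / Real.Gamma t := by
  induction m with
  | zero => simp
  | succ m ih =>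
    have hms : 0 < (m : ℝ) + s := by positivity
    have hmt : 0 < (m : ℝ) + t := by linarith
    have e1 : ((m + 1 : ℕ) : ℝ) + s = (m + s) + 1 := by push_cast; ring
    have e2 : ((m + 1 : ℕ) : ℝ) + t = (m + t) + 1 := by push_cast; ring
    rw [e1, e2, Real.Gamma_add_one hms.ne', Real.Gamma_add_one hmt.ne', mul_div_mul_comm]
    have h0 : 0 ≤ Real.Gamma (m + s) / Real.Gamma (m + t) :=
      div_nonneg (Real.Gamma_pos_of_pos hms).le (Real.Gamma_pos_of_pos hmt).le
    exact (mul_le_of_le_one_left h0 ((div_le_one hmt).2 (by linarith))).trans ih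

lemma Gamma_natCast_add_div_factorial_le {s : ℝ} (hs : 0 < s) (hs1 : s ≤ 1) (m : ℕ) :
    Real.Gamma (m + s) / (Nat.factorial m : ℝ) ≤ Real.Gamma s := by
  simpa [Real.Gamma_nat_eq_factorial] using Gamma_natCast_add_div_le hs hs1 m

lemma exists_gammaCoeff_le {n i : ℕ} (hi : i ≤ n) :
    ∃ C : ℝ, 0 ≤ C ∧ ∀ m : ℕ, gammaCoeff n i m ≤ C * ((m : ℝ) + 1) ^ i := by
  induction i with
  | zero => exact ⟨0, le_rfl, fun m => by simp [gammaCoeff]⟩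
  | succ i ih =>
    cases i with
    | zero =>
      refine ⟨1, zero_le_one, fun m => ?_⟩
      rw [gammaCoeff]
      split_ifs
      · simp
      · positivity
    | succ i =>
      have hn : 0 < n := by omega
      have hn' : (0 : ℝ) < n := by exact_mod_cast hn
      obtain ⟨C, hC, hle⟩ := ih (by omega)
      set s : ℝ := ((i : ℝ) + 1) * ((i : ℝ) + 2) / (2 * (n : ℝ)) with hs
      set t : ℝ := ((i : ℝ) + 2) * ((i : ℝ) + 3) / (2 * (n : ℝ)) with ht
      set q : ℝ := ((i : ℝ) + 2) / (n : ℝ) with hq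
      have hs0 : 0 < s := by positivity
      have ht0 : 0 < t := by positivity
      have hq0 : 0 < q := by positivity
      have hst : s ≤ t := by
        rw [hs, ht]
        gcongr ?_ / _
        nlinarith [Nat.cast_nonneg (α := ℝ) i]
      have hq1 : q ≤ 1 := by
        rw [hq, div_le_one hn']
        exact_mod_cast hi
      have hA : 0 ≤ Real.Gamma s / Real.Gamma t :=
        div_nonneg (Real.Gamma_pos_of_pos hs0).le (Real.Gamma_pos_of_pos ht0).le
      have hB : 0 ≤ Real.Gamma q := (Real.Gamma_pos_of_pos hq0).le
      refine ⟨Real.Gamma s / Real.Gamma t * (Real.Gamma q * C), by positivity, fun m => ?_⟩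
      rw [gammaCoeff]
      have hsum : ∑ k ∈ Finset.range (m + 1),
          (Real.Gamma (((m - k : ℕ) : ℝ) + q) / (Nat.factorial (m - k) : ℝ)) *
            gammaCoeff n (i + 1) k ≤ Real.Gamma q * C * ((m : ℝ) + 1) ^ (i + 2) := by
        calc _ ≤ ∑ k ∈ Finset.range (m + 1), Real.Gamma q * (C * ((m : ℝ) + 1) ^ (i + 1)) := by
              refine Finset.sum_le_sum fun k hk => mul_le_mul
                (Gamma_natCast_add_div_factorial_le hq0 hq1 _) ((hle k).trans ?_)
                (gammaCoeff_nonneg hn _ _) hB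
              have hkm : (k : ℝ) ≤ m := by
                exact_mod_cast Nat.lt_succ_iff.1 (Finset.mem_range.1 hk)
              gcongr
          _ = _ := by
              rw [Finset.sum_const, Finset.card_range, nsmul_eq_mul]
              push_cast
              ring
      calc _ ≤ Real.Gamma s / Real.Gamma t *
            (Real.Gamma q * C * ((m : ℝ) + 1) ^ (i + 2)) := by
            refine mul_le_mul (Gamma_natCast_add_div_le hs0 hst m) hsum
              (Finset.sum_nonneg fun k _ => mul_nonneg (div_nonneg
                (Real.Gamma_pos_of_pos (by positivity)).le (by positivity))
                (gammaCoeff_nonneg hn _ _)) hA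
        _ = _ := by ring

lemma summable_dCoeff_mul_pow {n : ℕ} (hn : 0 < n) {r : ℝ} (hr0 : 0 < r) (hr1 : r < 1) :
    Summable fun m : ℕ => dCoeff n m * r ^ m := by
  obtain ⟨C, -, hle⟩ := exists_gammaCoeff_le (Nat.sub_le n 1)
  have h : Summable fun m : ℕ => (m : ℝ) ^ (n - 1) * r ^ m :=
    summable_pow_mul_geometric_of_norm_lt_one _ (by rwa [Real.norm_of_nonneg hr0.le])
  refine Summable.of_nonneg_of_le
    (fun m => mul_nonneg (gammaCoeff_nonneg hn _ _) (by positivity)) (fun m => ?_)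
    (((summable_nat_add_iff 1).2 h).mul_left (C / r))
  calc dCoeff n m * r ^ m ≤ C * ((m : ℝ) + 1) ^ (n - 1) * r ^ m := by
        gcongr
        exact hle m
    _ = _ := by
        push_cast
        field_simp
        ring

lemma dCoeff_zero_le_Gfun {n : ℕ} (hn : 0 < n) {y : ℝ} (hy0 : 0 < y) (hy1 : y < 1) :
    dCoeff n 0 ≤ Gfun n y := by
  have h := (summable_dCoeff_mul_pow hn (sub_pos.2 hy1) (by linarith : 1 - y < 1)).le_tsum 0
    fun m _ => mul_nonneg (gammaCoeff_nonneg hn _ _) (pow_nonneg (sub_pos.2 hy1).le _)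
  simpa [Gfun] using h

lemma lintegral_const_mul_inv_one_sub_eq_top {c : ℝ} (hc : 0 < c) :
    ∫⁻ y in Ioo (1 / 2 : ℝ) 1, ENNReal.ofReal (c * (1 - y)⁻¹) = ⊤ := by
  by_contra hne
  have hint : IntegrableOn (fun y : ℝ => c * (1 - y)⁻¹) (Ioo (1 / 2) 1) := by
    refine ⟨by fun_prop, ?_⟩
    rw [hasFiniteIntegral_iff_ofReal]
    · exact lt_top_iff_ne_top.2 hne
    · filter_upwards [ae_restrict_mem measurableSet_Ioo] with y hy
      have := sub_pos.2 hy.2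
      positivity
  have hint' : IntervalIntegrable (fun y : ℝ => (y - 1)⁻¹) volume (1 / 2) 1 := by
    rw [intervalIntegrable_iff_integrableOn_Ioo_of_le (by norm_num)]
    refine IntegrableOn.congr_fun (hint.const_mul (-c⁻¹)) (fun y _ => ?_) measurableSet_Ioo
    have : (y - 1)⁻¹ = -(1 - y)⁻¹ := by rw [← inv_neg, neg_sub]
    simp only [this]
    field_simp
  rw [intervalIntegrable_sub_inv_iff] at hint'
  norm_num at hint'

/-- For `n = 4` or `n = 5` the UMVUE `u₀(Y)` of the shape parameter has infinite second
moment: `∫₀¹ y^{α−1}(1−y)^{(n−3)/2} G(y) u₀(y)² dy = +∞`, where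
`u₀(y) = ((n−3)/2) y/(1−y) + y (Σ_{m≥1} m d_m (1−y)^{m−1}) / G(y)`. -/
theorem umvue_shape_infinite_variance (n : ℕ) (hn : n = 4 ∨ n = 5) (a : ℝ) (ha : 0 < a) :
    ∫⁻ y in Ioo (0:ℝ) 1,
      ENNReal.ofReal (y ^ (a - 1) * (1 - y) ^ (((n : ℝ) - 3) / 2) * Gfun n y *
        ((((n : ℝ) - 3) / 2 * (y / (1 - y)) +
          y * (∑' m : ℕ, ((m : ℝ) + 1) * dCoeff n (m + 1) * (1 - y) ^ m) / Gfun n y) ^ 2))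
      = ⊤ := by
  have hn0 : 0 < n := by omega
  obtain ⟨hlo, hhi⟩ : (1 / 2 : ℝ) ≤ ((n : ℝ) - 3) / 2 ∧ ((n : ℝ) - 3) / 2 ≤ 1 := by
    rcases hn with rfl | rfl <;> norm_num
  have hd : 0 < dCoeff n 0 := by
    rw [dCoeff, show n - 1 = (n - 2) + 1 by omega]
    exact gammaCoeff_zero_pos hn0 _
  set q : ℝ := ((n : ℝ) - 3) / 2
  have hc : 0 < (1 / 2 : ℝ) ^ a * dCoeff n 0 * (1 / 16) := by positivity
  refine top_le_iff.1 ?_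
  rw [← lintegral_const_mul_inv_one_sub_eq_top hc]
  refine (setLIntegral_mono' measurableSet_Ioo fun y hy => ENNReal.ofReal_le_ofReal ?_).trans
    (lintegral_mono_set (Ioo_subset_Ioo_left (by norm_num)))
  obtain ⟨hy2, hy1⟩ := hy
  have hy0 : 0 < y := by linarith
  have h1y : 0 < 1 - y := sub_pos.2 hy1
  have hG := dCoeff_zero_le_Gfun hn0 hy0 hy1
  have hG0 : 0 < Gfun n y := hd.trans_le hG
  have hpow : (1 / 2 : ℝ) ^ a ≤ y ^ (a - 1) :=
    (Real.rpow_le_rpow (by norm_num) hy2.le ha.le).trans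
      (Real.rpow_le_rpow_of_exponent_ge hy0 hy1.le (by linarith))
  have hq : 1 - y ≤ (1 - y) ^ q := by
    simpa using Real.rpow_le_rpow_of_exponent_ge h1y (by linarith : 1 - y ≤ 1) hhi
  have hS : 0 ≤ ∑' m : ℕ, ((m : ℝ) + 1) * dCoeff n (m + 1) * (1 - y) ^ m :=
    tsum_nonneg fun m => mul_nonneg (mul_nonneg (by positivity) (gammaCoeff_nonneg hn0 _ _))
      (by positivity)
  have hu : 1 / 4 * (1 - y)⁻¹ ≤ q * (y / (1 - y)) +
      y * (∑' m : ℕ, ((m : ℝ) + 1) * dCoeff n (m + 1) * (1 - y) ^ m) / Gfun n y := by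
    refine le_add_of_le_of_nonneg ?_ (by positivity)
    rw [div_eq_mul_inv y, ← mul_assoc]
    gcongr
    nlinarith
  calc (1 / 2 : ℝ) ^ a * dCoeff n 0 * (1 / 16) * (1 - y)⁻¹
      = (1 / 2 : ℝ) ^ a * (1 - y) * dCoeff n 0 * (1 / 4 * (1 - y)⁻¹) ^ 2 := by
        field_simp
        norm_num
    _ ≤ _ := by gcongr
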